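/- For every word v over A = {a,b}, λ_v(ab) = a·ψ(v)·b. -/

import Mathlib

namespace Chri

/-- Length of the longest palindromic suffix of `w`. -/
def lpsLen (w : List Bool) : ℕ :=
  ((List.range (w.length + 1)).filter
    (fun l => w.drop (w.length - l) == (w.drop (w.length - l)).reverse)).foldr max 0

/-- Right palindromic closure: the shortest palindrome having `w` as a prefix. -/
def palClosure (w : List Bool) : List Bool :=
  w ++ (w.take (w.length - lpsLen w)).reverse

/-- The iterated palindromization map ψ. -/
def psi (v : List Bool) : List Bool :=
  v.foldl (fun w x => palClosure (w ++ [x])) []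

/-- Apply a substitution (morphism of the free monoid) letter by letter. -/
def applyM (f : Bool → List Bool) (w : List Bool) : List Bool := (w.map f).flatten

/-- μ_x : x ↦ x, y ↦ xy (a = false, b = true). -/
def muL (x : Bool) : List Bool → List Bool :=
  applyM (fun y => if y = x then [x] else [x, y])

/-- λ_a = μ_a; λ_b : a ↦ ab, b ↦ b. -/
def lamL : Bool → List Bool → List Bool
  | false => applyM (fun y => if y = false then [false] else [false, true])
  | true  => applyM (fun y => if y = true then [true] else [false, true])

/-- μ_{v₁⋯v_n} = μ_{v₁} ∘ ⋯ ∘ μ_{v_n}. -/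
def muW : List Bool → List Bool → List Bool
  | [], w => w
  | x :: v, w => muL x (muW v w)

/-- λ_{v₁⋯v_n} = λ_{v₁} ∘ ⋯ ∘ λ_{v_n}. -/
def lamW : List Bool → List Bool → List Bool
  | [], w => w
  | x :: v, w => lamL x (lamW v w)

/-- Christoffel words: the letters and the words aψ(v)b. -/
def IsChristoffel (w : List Bool) : Prop :=
  w = [false] ∨ w = [true] ∨ ∃ v, w = false :: (psi v ++ [true])

/-- A word is constant if it is a power of a single letter. -/
def IsConstant (v : List Bool) : Prop := ∃ x n, v = List.replicate n x

/-- ₊v : the longest proper suffix of v immediately preceded by the complement of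
the first letter of v. -/
def plusV (v : List Bool) : List Bool :=
  (v.dropWhile (fun y => y == v.headD false)).tail

/-- v₊ : the longest proper prefix of v immediately followed by the complement of
the last letter of v. -/
def vPlus (v : List Bool) : List Bool := (plusV v.reverse).reverse

/-- α₀: the length of the first maximal block of `v` (the index). -/
def blockLen (v : List Bool) : ℕ :=
  (v.takeWhile (fun y => y == v.headD false)).length

/-- The list of lengths of the maximal blocks of equal letters of `v`
(the integral representation (α₀, …, α_n)). -/
def blockLens : List Bool → List ℕ
  | [] => []
  | [_] => [1]
  | x :: y :: v =>
    if x = y then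
      match blockLens (y :: v) with
      | [] => [1]
      | n :: ns => (n + 1) :: ns
    else 1 :: blockLens (y :: v)

/-- ext(v) = number of maximal blocks of v. -/
def ext (v : List Bool) : ℕ := (blockLens v).length

/-- π(w): the minimal period of `w` (with π(ε) = 1). -/
noncomputable def minPeriod (w : List Bool) : ℕ :=
  sInf {p | 0 < p ∧ ∀ i, i + p < w.length → w.getD i false = w.getD (i + p) false}

/-- φ_k : a ↦ a^{k+1} b, b ↦ a^k b. -/
def phi (k : ℕ) : List Bool → List Bool :=
  applyM (fun y => if y = false then List.replicate (k + 1) false ++ [true]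
                   else List.replicate k false ++ [true])

/-- φ̂_k : a ↦ a b^k, b ↦ a b^{k+1}. -/
def phiHat (k : ℕ) : List Bool → List Bool :=
  applyM (fun y => if y = false then false :: List.replicate k true
                   else false :: List.replicate (k + 1) true)

attribute [local instance] Classical.propDecidable

/-- The derivative ∂w of a proper Christoffel word w = aψ(v)b of index k:
∂(ab) = a, and otherwise the preimage of w under φ_k (if v starts with a)
or φ̂_k (if v starts with b). -/
noncomputable def derivC (w : List Bool) : List Bool :=
  if w = [false, true] then [false]
  else if h : ∃ v, v ≠ [] ∧ w = false :: (psi v ++ [true]) then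
    if h.choose.headD false = false then Function.invFun (phi (blockLen h.choose)) w
    else Function.invFun (phiHat (blockLen h.choose)) w
  else w

/-- The depth of a Christoffel word: the least d with ∂^d w a single letter. -/
noncomputable def depth (w : List Bool) : ℕ :=
  sInf {d | derivC^[d] w = [false] ∨ derivC^[d] w = [true]}

/-- The height h(v): the least n ≥ 1 such that v_(n) is constant, where
v_(1) = v and v_(n+1) = ₊(v_(n)). -/
noncomputable def height (v : List Bool) : ℕ :=
  sInf {n | 0 < n ∧ IsConstant (plusV^[n - 1] v)}

/-- Helper computing δ_i from (α_{i-1}, δ_{i-1}) along the remaining exponents. -/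
def ruleAux : ℕ → ℕ → List ℕ → List ℕ
  | _, _, [] => []
  | pa, pd, a :: rest =>
    let d := if 1 < a then 1 else if 1 < pa then 0 else 1 - pd
    d :: ruleAux a d rest

/-- The sequence δ₀, δ₁, …, δ_n computed by the recursive rule (δ₀ = 1). -/
def ruleSeq : List ℕ → List ℕ
  | [] => []
  | a :: rest => 1 :: ruleAux a 1 rest

/-- δ(v) = Σ_{i=0}^n δ_i(v), where additionally δ_n(v) = 1; δ(ε) = 1. -/
def delta (v : List Bool) : ℕ := ((ruleSeq (blockLens v)).dropLast).sum + 1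

/-- |u₁|: length of the longest prefix x₀⋯x_i of u with i < n and α₀ = ⋯ = α_i = 1
(and 0 if α₀ > 1 or n = 0). -/
def u1len (u : List Bool) : ℕ :=
  min ((blockLens u).takeWhile (fun n => n == 1)).length ((blockLens u).length - 1)

/-- |u₂|: the symmetric notion for suffixes. -/
def u2len (u : List Bool) : ℕ := u1len u.reverse

/-- The sequence H: H(1) = 0, H(2n) = H(n), H(4n±1) = H(n)+1. -/
def H : ℕ → ℕ
  | 0 => 0
  | 1 => 0
  | n + 2 =>
    if (n + 2) % 2 = 0 then H ((n + 2) / 2)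
    else if (n + 2) % 4 = 1 then H ((n + 2) / 4) + 1
    else H ((n + 3) / 4) + 1
decreasing_by all_goals omega

/-- ⟨w⟩: the word w read as an integer in base 2 (a = 0, b = 1). -/
def wordVal (w : List Bool) : ℕ :=
  w.foldl (fun acc x => 2 * acc + (if x then 1 else 0)) 0

/-- Membership in X^*: w is a concatenation of words of X. -/
def InStar (X : Set (List Bool)) (w : List Bool) : Prop :=
  ∃ l : List (List Bool), (∀ u ∈ l, u ∈ X) ∧ w = l.flatten

/-- w ∈ x⁺. -/
def PowPos (x : Bool) (w : List Bool) : Prop := ∃ k, 0 < k ∧ w = List.replicate k x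

/-- `L` is the longest palindromic suffix of `w`. -/
structure IsLongestPalSuffix (L w : List Bool) : Prop where
  suffix : L <:+ w
  reverse_eq : L.reverse = L
  length_le : ∀ s, s <:+ w → s.reverse = s → s.length ≤ L.length

theorem exists_isLongestPalSuffix (w : List Bool) : ∃ L, IsLongestPalSuffix L w := by
  have h : ∃ k, (w.drop k).reverse = w.drop k := ⟨w.length, by simp⟩
  refine ⟨w.drop (Nat.find h), w.drop_suffix _, Nat.find_spec h, fun s hs hp => ?_⟩
  have hs' := List.suffix_iff_eq_drop.1 hs
  have hk : Nat.find h ≤ w.length - s.length := Nat.find_min' h (by rw [← hs', hp])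
  have hl := hs.length_le
  rw [List.length_drop]
  omega

theorem le_foldr_max {l : List ℕ} {n : ℕ} (hn : n ∈ l) : n ≤ l.foldr max 0 := by
  induction l with
  | nil => simp at hn
  | cons m l ih =>
    rcases List.mem_cons.1 hn with rfl | hn
    · simp
    · exact (ih hn).trans (by simp)

theorem foldr_max_le {l : List ℕ} {n : ℕ} (hn : ∀ m ∈ l, m ≤ n) : l.foldr max 0 ≤ n := by
  induction l with
  | nil => simp
  | cons m l ih =>
    exact max_le (hn m (by simp)) (ih fun k hk => hn k (by simp [hk]))

theorem IsLongestPalSuffix.lpsLen_eq {L w : List Bool} (h : IsLongestPalSuffix L w) :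
    lpsLen w = L.length := by
  apply le_antisymm
  · refine foldr_max_le fun m hm => ?_
    simp only [List.mem_filter, List.mem_range, beq_iff_eq] at hm
    have := h.length_le _ (w.drop_suffix (w.length - m)) hm.2.symm
    rw [List.length_drop] at this
    omega
  · refine le_foldr_max ?_
    have hd := List.suffix_iff_eq_drop.1 h.suffix
    have hl := h.suffix.length_le
    simp only [List.mem_filter, List.mem_range, beq_iff_eq]
    exact ⟨by omega, by rw [← hd, h.reverse_eq]⟩

theorem IsLongestPalSuffix.palClosure_eq {u L : List Bool}
    (h : IsLongestPalSuffix L (u ++ L)) : palClosure (u ++ L) = u ++ L ++ u.reverse := by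
  simp [palClosure, h.lpsLen_eq]

theorem muL_nil (x : Bool) : muL x [] = [] := rfl

theorem muL_append (x : Bool) (u v : List Bool) : muL x (u ++ v) = muL x u ++ muL x v := by
  simp [muL, applyM]

theorem muL_cons_self (x : Bool) (w : List Bool) : muL x (x :: w) = x :: muL x w := by
  simp [muL, applyM]

theorem muL_cons_not (x : Bool) (w : List Bool) :
    muL x ((!x) :: w) = x :: (!x) :: muL x w := by
  simp [muL, applyM]

theorem cons_reverse_muL (x : Bool) (w : List Bool) :
    x :: (muL x w).reverse = muL x w.reverse ++ [x] := by
  induction w with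
  | nil => rfl
  | cons y w ih =>
    rcases Bool.eq_or_eq_not y x with rfl | rfl
    · simp [muL_cons_self, muL_append, muL_nil, ← List.cons_append, ih]
    · simp [muL_cons_not, muL_append, muL_nil, ← List.cons_append, ih]

theorem muL_ne_not_cons (x : Bool) (w t : List Bool) :
    muL x w ≠ (!x) :: t := by
  cases w with
  | nil => simp [muL_nil]
  | cons y w =>
    rcases Bool.eq_or_eq_not y x with rfl | rfl
    · simp [muL_cons_self]
    · simp [muL_cons_not]

theorem muL_injective (x : Bool) : Function.Injective (muL x) := by
  intro u
  induction u with
  | nil =>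
    rintro (_ | ⟨z, v⟩) h
    · rfl
    · rcases Bool.eq_or_eq_not z x with rfl | rfl
      · simp [muL_nil, muL_cons_self] at h
      · simp [muL_nil, muL_cons_not] at h
  | cons y u ih =>
    rintro (_ | ⟨z, v⟩) h
    · rcases Bool.eq_or_eq_not y x with rfl | rfl
      · simp [muL_nil, muL_cons_self] at h
      · simp [muL_nil, muL_cons_not] at h
    · rcases Bool.eq_or_eq_not y x with hy | hy <;>
        rcases Bool.eq_or_eq_not z x with hz | hz <;> rw [hy, hz] at h ⊢ <;>
        simp only [muL_cons_self, muL_cons_not, List.cons.injEq, true_and] at h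
      · rw [ih h]
      · exact absurd h (muL_ne_not_cons _ _ _)
      · exact absurd h.symm (muL_ne_not_cons _ _ _)
      · rw [ih h]

theorem reverse_muL_append (x : Bool) (w : List Bool) :
    (muL x w ++ [x]).reverse = muL x w.reverse ++ [x] := by
  simp [← cons_reverse_muL]

theorem suffix_muL (x : Bool) {z w : List Bool} (h : z <:+ muL x w) :
    (∃ s, s <:+ w ∧ z = muL x s) ∨ ∃ s, (!x) :: s <:+ w ∧ z = (!x) :: muL x s := by
  induction w with
  | nil => exact Or.inl ⟨[], by simp, by simpa [muL_nil] using h⟩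
  | cons y w ih =>
    have lift : z <:+ muL x w → (∃ s, s <:+ y :: w ∧ z = muL x s) ∨
        ∃ s, (!x) :: s <:+ y :: w ∧ z = (!x) :: muL x s := fun hz =>
      (ih hz).imp (fun ⟨s, hs, e⟩ => ⟨s, hs.trans (List.suffix_cons _ _), e⟩)
        (fun ⟨s, hs, e⟩ => ⟨s, hs.trans (List.suffix_cons _ _), e⟩)
    rcases Bool.eq_or_eq_not y x with rfl | rfl
    · rw [muL_cons_self, List.suffix_cons_iff] at h
      rcases h with h | h
      · exact Or.inl ⟨y :: w, List.suffix_rfl, by rw [h, muL_cons_self]⟩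
      · exact lift h
    · rw [muL_cons_not, List.suffix_cons_iff, List.suffix_cons_iff] at h
      rcases h with h | h | h
      · exact Or.inl ⟨(!x) :: w, List.suffix_rfl, by rw [h, muL_cons_not]⟩
      · exact Or.inr ⟨w, List.suffix_rfl, h⟩
      · exact lift h

theorem muL_suffix_muL (x : Bool) {s w : List Bool} (h : s <:+ w) : muL x s <:+ muL x w := by
  obtain ⟨t, rfl⟩ := h
  exact ⟨muL x t, (muL_append x t s).symm⟩

theorem IsLongestPalSuffix.muL_append_self (x : Bool) {L w : List Bool}
    (h : IsLongestPalSuffix L w) :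
    IsLongestPalSuffix (muL x L ++ [x]) (muL x w ++ [x]) := by
  refine ⟨?_, by rw [reverse_muL_append, h.reverse_eq], fun z hz hp => ?_⟩
  · obtain ⟨t, ht⟩ := muL_suffix_muL x h.suffix
    exact ⟨t, by rw [← List.append_assoc, ht]⟩
  · rcases List.suffix_concat_iff.1 hz with rfl | ⟨t, rfl, ht⟩
    · simp
    · rcases suffix_muL x ht with ⟨s, hs, rfl⟩ | ⟨s, -, rfl⟩
      · rw [reverse_muL_append] at hp
        have hs' := h.length_le s hs (muL_injective x (List.append_cancel_right hp))
        have := (muL_suffix_muL x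
          (List.suffix_of_suffix_length_le hs h.suffix hs')).length_le
        simpa using this
      · simp at hp

theorem palClosure_muL_append_self (x : Bool) (w : List Bool) :
    palClosure (muL x w ++ [x]) = muL x (palClosure w) ++ [x] := by
  obtain ⟨L, h⟩ := exists_isLongestPalSuffix w
  obtain ⟨u, rfl⟩ := h.suffix
  have h' := h.muL_append_self x
  rw [muL_append, List.append_assoc] at h' ⊢
  rw [h'.palClosure_eq, h.palClosure_eq]
  simp [muL_append, ← cons_reverse_muL]

theorem palClosure_muL_concat_not (x : Bool) (w : List Bool) :
    palClosure (muL x (w ++ [!x])) = muL x (palClosure (w ++ [!x])) ++ [x] := by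
  obtain ⟨L, h⟩ := exists_isLongestPalSuffix (w ++ [!x])
  have hL : L ≠ [] := by
    rintro rfl
    simpa using h.length_le [!x] (List.suffix_append _ _) rfl
  obtain ⟨M, rfl⟩ : ∃ M, L = (!x) :: M := by
    rcases List.suffix_concat_iff.1 h.suffix with rfl | ⟨t, rfl, -⟩
    · exact absurd rfl hL
    · have := h.reverse_eq
      cases t with
      | nil => exact ⟨[], rfl⟩
      | cons y t =>
        simp only [List.reverse_append, List.reverse_cons, List.reverse_nil, List.nil_append,
          List.cons_append, List.cons.injEq] at this
        exact ⟨t ++ [!x], by rw [this.1]; rfl⟩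
  obtain ⟨u, hu⟩ := h.suffix
  have h' := h.muL_append_self x
  have hlps : IsLongestPalSuffix ((!x) :: muL x M) ((muL x u ++ [x]) ++ (!x) :: muL x M) := by
    refine ⟨List.suffix_append _ _, ?_, fun z hz hp => ?_⟩
    · exact List.append_cancel_right (bs := [x])
        (by simpa [muL_cons_not] using h'.reverse_eq)
    · have hmu : (muL x u ++ [x]) ++ (!x) :: muL x M = muL x (w ++ [!x]) := by
        simp [← hu, muL_append, muL_cons_not]
      rw [hmu] at hz
      have hxz : z = [] ∨ x :: z <:+ muL x (w ++ [!x]) := by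
        rcases suffix_muL x hz with ⟨s, hs, rfl⟩ | ⟨s, hs, rfl⟩
        · rcases List.suffix_concat_iff.1 hs with rfl | ⟨t, rfl, -⟩
          · exact Or.inl rfl
          · exfalso
            have hr : (muL x (t ++ [!x])).reverse = (!x) :: x :: (muL x t).reverse := by
              simp [muL_append, muL_cons_not, muL_nil]
            exact muL_ne_not_cons _ _ _ (hp.symm.trans hr)
        · refine Or.inr ?_
          rw [← muL_cons_not]
          exact muL_suffix_muL x hs
      rcases hxz with rfl | hxz
      · simp
      · obtain ⟨t, ht⟩ := hxz
        have := h'.length_le (x :: z ++ [x]) ⟨t, by rw [← List.append_assoc, ht]⟩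
          (by simp [hp])
        simp [muL_cons_not] at this
        simpa using this
  have e := hlps.palClosure_eq
  rw [← hu] at h ⊢
  rw [h.palClosure_eq]
  simpa [muL_append, muL_cons_not, ← cons_reverse_muL] using e

theorem psi_concat (v : List Bool) (y : Bool) : psi (v ++ [y]) = palClosure (psi v ++ [y]) := by
  simp [psi]

theorem psi_cons (x : Bool) (v : List Bool) : psi (x :: v) = muL x (psi v) ++ [x] := by
  induction v using List.reverseRecOn with
  | nil => cases x <;> decide
  | append_singleton v y ih =>
    rw [← List.cons_append, psi_concat, psi_concat, ih]
    rcases Bool.eq_or_eq_not y x with rfl | rfl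
    · rw [← palClosure_muL_append_self, muL_append, muL_cons_self, muL_nil]
    · rw [← palClosure_muL_concat_not, muL_append, muL_cons_not, muL_nil]
      simp

theorem lamL_append (x : Bool) (u v : List Bool) :
    lamL x (u ++ v) = lamL x u ++ lamL x v := by
  cases x <;> simp [lamL, applyM]

theorem lamL_false (w : List Bool) : lamL false w = muL false w := by
  simp only [lamL, muL]
  congr 1
  funext y
  cases y <;> rfl

theorem cons_lamL_true (w : List Bool) : true :: lamL true w = muL true w ++ [true] := by
  induction w with
  | nil => rfl
  | cons y w ih => cases y <;> simpa [lamL, muL, applyM] using ih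

/-- λ_v(ab) = a·ψ(v)·b. -/
theorem lamW_ab (v : List Bool) :
    lamW v [false, true] = false :: (psi v ++ [true]) := by
  induction v with
  | nil => rfl
  | cons x v ih =>
    rw [lamW, ih, psi_cons, ← List.singleton_append, lamL_append, lamL_append]
    cases x
    · simp [lamL_false, muL, applyM]
    · rw [← cons_lamL_true]
      simp [lamL, applyM]

end Chri
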